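/- arXiv:1512.05702 — 3 statements merged into one kernel-verified Lean document; each statement's English description precedes it below -/
import Mathlib

section
/- Let K be a compact subset of ℝ^n and F : K → ℝ^n a continuous mapping. Then for any ε > 0 there exist an integer m ≥ 1, an n × m real matrix A, an m × n real matrix B, and a vector θ ∈ ℝ^m such that max_{q ∈ K} ‖F(q) − A σ(B q + θ)‖ < ε, where σ : ℝ^m → ℝ^m applies the logistic sigmoid componentwise. -/
/-- The logistic sigmoid function. -/
noncomputable def sigmoid (x : ℝ) : ℝ := 1 / (1 + Real.exp (-x))

noncomputable def expC {n : ℕ} (K : Set (EuclideanSpace ℝ (Fin n))) (w : Fin n → ℝ) : C(K, ℝ) :=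
  ⟨fun q => Real.exp (∑ i, w i * q.1 i), by fun_prop⟩

lemma sigmoid_cont : Continuous sigmoid := by
  unfold sigmoid
  refine Continuous.div (by fun_prop) (by fun_prop) (fun x => ?_)
  positivity

noncomputable def sigC {n : ℕ} (K : Set (EuclideanSpace ℝ (Fin n))) (p : (Fin n → ℝ) × ℝ) :
    C(K, ℝ) :=
  ⟨fun q => sigmoid (∑ i, p.1 i * q.1 i + p.2), sigmoid_cont.comp (by fun_prop)⟩

lemma exp_sub_sigmoid (s t : ℝ) :
    |Real.exp t - Real.exp s * sigmoid (t - s)| ≤ Real.exp (2 * t) * Real.exp (-s) := by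
  have h : Real.exp t - Real.exp s * sigmoid (t - s)
      = Real.exp (2 * t) * Real.exp (-s) / (1 + Real.exp t * Real.exp (-s)) := by
    unfold sigmoid
    rw [two_mul, Real.exp_add, neg_sub, Real.exp_sub, Real.exp_neg]
    have := Real.exp_pos t
    have := Real.exp_pos s
    field_simp
    ring
  rw [h, abs_of_nonneg (by positivity)]
  apply div_le_self (by positivity)
  have : 0 < Real.exp t * Real.exp (-s) := by positivity
  linarith

lemma expC_mem {n : ℕ} (K : Set (EuclideanSpace ℝ (Fin n))) [CompactSpace K] (w : Fin n → ℝ) :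
    expC K w ∈ (Submodule.span ℝ (Set.range (sigC K))).topologicalClosure := by
  change expC K w ∈ closure _
  have hlim : Filter.Tendsto (fun s : ℝ => Real.exp s • sigC K (w, -s)) Filter.atTop
      (nhds (expC K w)) := by
    rw [tendsto_iff_norm_sub_tendsto_zero]
    have hz : Filter.Tendsto (fun s : ℝ => ‖expC K w * expC K w‖ * Real.exp (-s)) Filter.atTop
        (nhds 0) := by
      simpa using Real.tendsto_exp_neg_atTop_nhds_zero.const_mul ‖expC K w * expC K w‖
    refine squeeze_zero (fun _ => norm_nonneg _) (fun s => ?_) hz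
    rw [ContinuousMap.norm_le _ (by positivity)]
    intro q
    have h1 := exp_sub_sigmoid s (∑ i, w i * q.1 i)
    have h2 := (expC K w * expC K w).norm_coe_le_norm q
    have h3 : ‖(expC K w * expC K w) q‖ = Real.exp (2 * ∑ i, w i * q.1 i) := by
      simp only [expC, ContinuousMap.mul_apply, ContinuousMap.coe_mk]
      rw [← Real.exp_add, ← two_mul, Real.norm_eq_abs, Real.abs_exp]
    rw [h3] at h2
    rw [ContinuousMap.sub_apply, norm_sub_rev, Real.norm_eq_abs]
    exact h1.trans (mul_le_mul_of_nonneg_right h2 (Real.exp_pos _).le)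
  refine mem_closure_of_tendsto hlim (Filter.Eventually.of_forall fun s => ?_)
  exact Submodule.smul_mem _ _ (Submodule.subset_span ⟨_, rfl⟩)

lemma sigC_dense {n : ℕ} (K : Set (EuclideanSpace ℝ (Fin n))) [CompactSpace K] (f : C(K, ℝ)) :
    f ∈ closure (Submodule.span ℝ (Set.range (sigC K)) : Set C(K, ℝ)) := by
  have hsep : (Algebra.adjoin ℝ (Set.range (expC K))).SeparatesPoints := by
    intro x y hxy
    have : ∃ i, x.1 i ≠ y.1 i := by
      by_contra! h
      exact hxy (Subtype.ext (PiLp.ext h))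
    obtain ⟨i, hi⟩ := this
    refine ⟨expC K (Pi.single i 1), ⟨_, Algebra.subset_adjoin ⟨_, rfl⟩, rfl⟩, ?_⟩
    simpa [expC, Pi.single_apply] using hi
  have htop := ContinuousMap.subalgebra_topologicalClosure_eq_top_of_separatesPoints _ hsep
  have hmon : ∀ g ∈ Submonoid.closure (Set.range (expC K)), ∃ w, expC K w = g := by
    intro g hg
    induction hg using Submonoid.closure_induction with
    | mem x hx => exact hx
    | one => exact ⟨0, by ext; simp [expC]⟩
    | mul x y _ _ hx hy =>
      obtain ⟨v, rfl⟩ := hx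
      obtain ⟨w, rfl⟩ := hy
      exact ⟨v + w, by ext; simp [expC, add_mul, Finset.sum_add_distrib, Real.exp_add]⟩
  have hle : ((Algebra.adjoin ℝ (Set.range (expC K)) : Subalgebra ℝ C(K, ℝ)) : Set C(K, ℝ)) ⊆
      closure (Submodule.span ℝ (Set.range (sigC K)) : Set C(K, ℝ)) := by
    intro g hg
    have hg' : g ∈ Subalgebra.toSubmodule (Algebra.adjoin ℝ (Set.range (expC K))) := hg
    rw [Algebra.adjoin_eq_span] at hg'
    have : Submodule.span ℝ (Submonoid.closure (Set.range (expC K)) : Set C(K, ℝ)) ≤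
        (Submodule.span ℝ (Set.range (sigC K))).topologicalClosure := by
      rw [Submodule.span_le]
      intro g hg
      obtain ⟨w, rfl⟩ := hmon g hg
      exact expC_mem K w
    exact this hg'
  have hf : f ∈ (Algebra.adjoin ℝ (Set.range (expC K))).topologicalClosure := by
    rw [htop]; trivial
  exact closure_minimal hle isClosed_closure hf

lemma norm_lt_of_coord {n : ℕ} (v : EuclideanSpace ℝ (Fin n)) (ε : ℝ) (hε : 0 < ε)
    (h : ∀ i, |v i| < ε / (n + 1)) : ‖v‖ < ε := by
  rw [EuclideanSpace.norm_eq, Real.sqrt_lt' hε]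
  have hn : (0 : ℝ) ≤ n := n.cast_nonneg
  have hd : 0 < ε / (n + 1) := by positivity
  have h1 : ∑ i, ‖v i‖ ^ 2 ≤ ∑ _i : Fin n, (ε / (n + 1)) ^ 2 := by
    refine Finset.sum_le_sum fun i _ => ?_
    exact pow_le_pow_left₀ (norm_nonneg _) (h i).le 2
  have h2 : ε = (n + 1) * (ε / (n + 1)) := by field_simp
  rw [Finset.sum_const, Finset.card_univ, Fintype.card_fin, nsmul_eq_mul] at h1
  refine h1.trans_lt ?_
  conv_rhs => rw [h2]
  rw [mul_pow]
  refine mul_lt_mul_of_pos_right ?_ (by positivity)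
  nlinarith

/-- **Fundamental approximation theorem** (Funahashi 1989, Theorem 2 of the paper):
any continuous map `F` on a compact set `K ⊆ ℝⁿ` can be uniformly approximated to within
`ε` by a three-layer feedforward network `q ↦ A σ (B q + θ)` with componentwise logistic
sigmoid activations. -/
theorem feedforward_universal_approximation
    (n : ℕ) (K : Set (EuclideanSpace ℝ (Fin n))) (hK : IsCompact K)
    (F : EuclideanSpace ℝ (Fin n) → EuclideanSpace ℝ (Fin n)) (hF : ContinuousOn F K)
    (ε : ℝ) (hε : 0 < ε) :
    ∃ (m : ℕ) (A : Matrix (Fin n) (Fin m) ℝ) (B : Matrix (Fin m) (Fin n) ℝ)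
      (θ : EuclideanSpace ℝ (Fin m)), 1 ≤ m ∧
      ∀ q ∈ K,
        ‖F q - (EuclideanSpace.equiv (Fin n) ℝ).symm
            (A.mulVec (fun j => sigmoid (B.mulVec q j + θ j)))‖ < ε := by
  classical
  have : CompactSpace K := isCompact_iff_compactSpace.mp hK
  have hn : (0 : ℝ) ≤ n := n.cast_nonneg
  have hd : 0 < ε / (n + 1) := by positivity
  have hFc : Continuous (fun q : K => F q.1) := continuousOn_iff_continuous_domRestrict.mp hF
  let f : Fin n → C(K, ℝ) := fun i => ⟨fun q => F q.1 i,
    (EuclideanSpace.proj (𝕜 := ℝ) i).continuous.comp hFc⟩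
  have happ : ∀ i, ∃ c : ((Fin n → ℝ) × ℝ) →₀ ℝ,
      ‖f i - c.sum (fun p a => a • sigC K p)‖ < ε / (n + 1) := by
    intro i
    obtain ⟨g, hg, hfg⟩ := Metric.mem_closure_iff.mp (sigC_dense K (f i)) _ hd
    obtain ⟨c, rfl⟩ := Finsupp.mem_span_range_iff_exists_finsupp.mp hg
    exact ⟨c, by rwa [dist_eq_norm] at hfg⟩
  choose c hc using happ
  let T : Finset ((Fin n → ℝ) × ℝ) := insert 0 (Finset.univ.biUnion fun i => (c i).support)
  let e := T.equivFin
  refine ⟨T.card, fun i j => c i (e.symm j).1, fun j i => (e.symm j).1.1 i,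
    WithLp.toLp 2 fun j => (e.symm j).1.2, Finset.card_pos.mpr ⟨0, by simp [T]⟩, ?_⟩
  intro q hq
  refine norm_lt_of_coord _ ε hε fun i => ?_
  have h1 := ((f i - (c i).sum (fun p a => a • sigC K p)).norm_coe_le_norm ⟨q, hq⟩).trans_lt (hc i)
  have h2 : (c i).sum (fun p a => a • sigC K p) = ∑ p ∈ T, c i p • sigC K p := by
    refine Finsupp.sum_of_support_subset _ ?_ _ (by simp)
    intro p hp
    exact Finset.mem_insert_of_mem (Finset.mem_biUnion.mpr ⟨i, Finset.mem_univ _, hp⟩)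
  rw [h2, Real.norm_eq_abs] at h1
  refine lt_of_eq_of_lt (congrArg abs ?_) h1
  simp only [ContinuousMap.sub_apply, ContinuousMap.coe_sum, Finset.sum_apply,
    ContinuousMap.coe_smul, Pi.smul_apply, smul_eq_mul]
  rw [← Finset.sum_coe_sort T, ← e.symm.sum_comp]
  rfl
end

section
/- Let τ > 0, A ∈ ℝ^{n×m}, B ∈ ℝ^{m×n}, θ ∈ ℝ^m, and let σ apply the logistic sigmoid componentwise. Suppose ω : [0, ∞) → ℝ^n and η : [0, ∞) → ℝ^m satisfy the recurrent-network equations ω̇ = −(1/τ)ω + A σ(η) and η̇ = −(1/τ)η + B A σ(η), with initial hidden state η(0) = B ω(0) + θ. Define r(t) = B ω(t) + θ. Then for all t ≥ 0, r(t) − η(t) = (1 − e^{−t/τ}) θ; equivalently, B ω(t) + θ − η(t) = (1 − e^{−t/τ}) θ. -/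
/-- **Hidden-state identity** (Section 4.2 of the paper): if the outputs `ω` and
hidden states `η` of a recurrent network evolve by `ω̇ = -(1/τ)ω + A σ(η)` and
`η̇ = -(1/τ)η + B A σ(η)` for `t ≥ 0`, with hidden initialization
`η(0) = B ω(0) + θ`, then the affine approximator `r(t) = B ω(t) + θ` satisfies
`r(t) − η(t) = (1 − e^{−t/τ}) θ` for all `t ≥ 0`. -/
theorem hidden_state_affine_identity
    (n m : ℕ) (τ : ℝ) (hτ : 0 < τ)
    (A : Matrix (Fin n) (Fin m) ℝ) (B : Matrix (Fin m) (Fin n) ℝ)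
    (θ : EuclideanSpace ℝ (Fin m))
    (ω : ℝ → EuclideanSpace ℝ (Fin n)) (η : ℝ → EuclideanSpace ℝ (Fin m))
    (hω : ∀ t, 0 ≤ t →
      HasDerivAt ω
        ((-(1 / τ)) • ω t + (EuclideanSpace.equiv (Fin n) ℝ).symm
          (A.mulVec (fun j => sigmoid (η t j)))) t)
    (hη : ∀ t, 0 ≤ t →
      HasDerivAt η
        ((-(1 / τ)) • η t + (EuclideanSpace.equiv (Fin m) ℝ).symm
          ((B * A).mulVec (fun j => sigmoid (η t j)))) t)
    (h0 : η 0 = (EuclideanSpace.equiv (Fin m) ℝ).symm (B.mulVec (ω 0)) + θ) :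
    ∀ t, 0 ≤ t →
      (EuclideanSpace.equiv (Fin m) ℝ).symm (B.mulVec (ω t)) + θ - η t
        = (1 - Real.exp (-t / τ)) • θ := by
  intro T hT
  ext i
  have hωj : ∀ j t, 0 ≤ t → HasDerivAt (fun s => ω s j)
      (-(1 / τ) * ω t j + A.mulVec (fun j => sigmoid (η t j)) j) t := by
    intro j t ht
    have h := (EuclideanSpace.proj (𝕜 := ℝ) j).hasFDerivAt.comp_hasDerivAt t (hω t ht)
    simpa [Function.comp_def] using h
  have hηi : ∀ t, 0 ≤ t → HasDerivAt (fun s => η s i)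
      (-(1 / τ) * η t i + (B * A).mulVec (fun j => sigmoid (η t j)) i) t := by
    intro t ht
    have h := (EuclideanSpace.proj (𝕜 := ℝ) i).hasFDerivAt.comp_hasDerivAt t (hη t ht)
    simpa [Function.comp_def] using h
  have hf : ∀ t, 0 ≤ t → HasDerivAt
      (fun s => Real.exp (s / τ) * ((∑ j, B i j * ω s j) - η s i)) 0 t := by
    intro t ht
    have hs : HasDerivAt (fun s => ∑ j, B i j * ω s j)
        (∑ j, B i j * (-(1 / τ) * ω t j + A.mulVec (fun j => sigmoid (η t j)) j)) t :=
      HasDerivAt.fun_sum fun j _ => (hωj j t ht).const_mul (B i j)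
    have he : HasDerivAt (fun s : ℝ => Real.exp (s / τ)) (Real.exp (t / τ) * (1 / τ)) t :=
      ((hasDerivAt_id t).div_const τ).exp
    have e1 : (B * A).mulVec (fun j => sigmoid (η t j)) i
        = ∑ j, B i j * A.mulVec (fun j => sigmoid (η t j)) j := by
      rw [← Matrix.mulVec_mulVec]; rfl
    have e2 : (∑ j, B i j * (-(1 / τ) * ω t j + A.mulVec (fun j => sigmoid (η t j)) j))
        = -(1 / τ) * (∑ j, B i j * ω t j)
          + ∑ j, B i j * A.mulVec (fun j => sigmoid (η t j)) j := by
      rw [Finset.mul_sum, ← Finset.sum_add_distrib]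
      exact Finset.sum_congr rfl fun j _ => by ring
    refine (he.mul (hs.sub (hηi t ht))).congr_deriv ?_
    rw [e2, e1]
    simp only [Pi.sub_apply]
    ring
  have hc := constant_of_has_deriv_right_zero (a := 0) (b := T)
    (fun t ht => (hf t ht.1).continuousAt.continuousWithinAt)
    (fun t ht => (hf t ht.1).hasDerivWithinAt) T ⟨hT, le_rfl⟩
  have h0i : η 0 i = (∑ j, B i j * ω 0 j) + θ i := by
    rw [h0]; rfl
  have hg : (∑ j, B i j * ω T j) + θ i - η T i = (1 - Real.exp (-T / τ)) * θ i := by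
    simp only [zero_div, Real.exp_zero, h0i] at hc
    have hm : Real.exp (-T / τ) * Real.exp (T / τ) = 1 := by
      rw [← Real.exp_add, neg_div, neg_add_cancel, Real.exp_zero]
    linear_combination Real.exp (-T / τ) * hc - ((∑ j, B i j * ω T j) - η T i) * hm
  exact hg
end

section
/- Under the hypotheses of the hidden-state identity (ω̇ = −(1/τ)ω + A σ(η), η̇ = −(1/τ)η + B A σ(η), η(0) = B ω(0) + θ, r(t) = B ω(t) + θ), define δ(t) = ‖r(t) − η(t)‖. Then δ(t) = (1 − e^{−t/τ}) ‖θ‖ for all t ≥ 0; consequently δ is differentiable with δ′(t) = (‖θ‖/τ) e^{−t/τ} ≤ ‖θ‖/τ for all t ≥ 0, and δ(t) ≤ (t/τ) ‖θ‖. In particular, when the time constant τ is large, the hidden states stay close to the affine image B ω(t) + θ of the output states, with discrepancy growing at rate at most ‖θ‖/τ. -/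
/-- **Growth rate of the hidden-state discrepancy** (Section 4.2 of the paper): under
the hypotheses of the hidden-state identity, `δ(t) = ‖r(t) − η(t)‖` (with
`r(t) = B ω(t) + θ`) satisfies `δ(t) = (1 − e^{−t/τ}) ‖θ‖` for all `t ≥ 0`;
consequently `δ` is differentiable on `[0, ∞)` with
`δ′(t) = (‖θ‖/τ) e^{−t/τ} ≤ ‖θ‖/τ`, and `δ(t) ≤ (t/τ) ‖θ‖`. -/
theorem hidden_state_discrepancy_rate
    (n m : ℕ) (τ : ℝ) (hτ : 0 < τ)
    (A : Matrix (Fin n) (Fin m) ℝ) (B : Matrix (Fin m) (Fin n) ℝ)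
    (θ : EuclideanSpace ℝ (Fin m))
    (ω : ℝ → EuclideanSpace ℝ (Fin n)) (η : ℝ → EuclideanSpace ℝ (Fin m))
    (hω : ∀ t, 0 ≤ t →
      HasDerivAt ω
        ((-(1 / τ)) • ω t + (EuclideanSpace.equiv (Fin n) ℝ).symm
          (A.mulVec (fun j => sigmoid (η t j)))) t)
    (hη : ∀ t, 0 ≤ t →
      HasDerivAt η
        ((-(1 / τ)) • η t + (EuclideanSpace.equiv (Fin m) ℝ).symm
          ((B * A).mulVec (fun j => sigmoid (η t j)))) t)
    (h0 : η 0 = (EuclideanSpace.equiv (Fin m) ℝ).symm (B.mulVec (ω 0)) + θ) :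
    ∀ t, 0 ≤ t →
      ‖(EuclideanSpace.equiv (Fin m) ℝ).symm (B.mulVec (ω t)) + θ - η t‖
        = (1 - Real.exp (-t / τ)) * ‖θ‖ ∧
      HasDerivWithinAt
        (fun u => ‖(EuclideanSpace.equiv (Fin m) ℝ).symm (B.mulVec (ω u)) + θ - η u‖)
        ((‖θ‖ / τ) * Real.exp (-t / τ)) (Set.Ici (0 : ℝ)) t ∧
      (‖θ‖ / τ) * Real.exp (-t / τ) ≤ ‖θ‖ / τ ∧
      ‖(EuclideanSpace.equiv (Fin m) ℝ).symm (B.mulVec (ω t)) + θ - η t‖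
        ≤ (t / τ) * ‖θ‖ := by
  let L : EuclideanSpace ℝ (Fin n) →L[ℝ] EuclideanSpace ℝ (Fin m) :=
    ((EuclideanSpace.equiv (Fin m) ℝ).symm : (Fin m → ℝ) →L[ℝ] EuclideanSpace ℝ (Fin m)) ∘L
      (LinearMap.toContinuousLinearMap (Matrix.mulVecLin B)) ∘L
      ((EuclideanSpace.equiv (Fin n) ℝ) : EuclideanSpace ℝ (Fin n) →L[ℝ] (Fin n → ℝ))
  have hL : ∀ x : EuclideanSpace ℝ (Fin n),
      (EuclideanSpace.equiv (Fin m) ℝ).symm (B.mulVec x) = L x := fun x => rfl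
  have hLA : ∀ v : Fin m → ℝ, L ((EuclideanSpace.equiv (Fin n) ℝ).symm (A.mulVec v))
      = (EuclideanSpace.equiv (Fin m) ℝ).symm ((B * A).mulVec v) := by
    intro v
    rw [← Matrix.mulVec_mulVec]
    rfl
  simp only [hL] at h0 ⊢
  have hz : ∀ t, 0 ≤ t → HasDerivAt (fun u => L (ω u) - η u)
      ((-(1 / τ)) • (L (ω t) - η t)) t := by
    intro t ht
    have h1 := (L.hasFDerivAt.comp_hasDerivAt t (hω t ht)).sub (hη t ht)
    refine h1.congr_deriv ?_
    rw [map_add, map_smul, hLA, smul_sub]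
    abel
  have he : ∀ t : ℝ, HasDerivAt (fun u => Real.exp (u / τ)) (Real.exp (t / τ) * (1 / τ)) t :=
    fun t => ((hasDerivAt_id t).div_const τ).exp
  have hg : ∀ t, 0 ≤ t →
      HasDerivAt (fun u => Real.exp (u / τ) • (L (ω u) - η u)) 0 t := by
    intro t ht
    refine ((he t).smul (hz t ht)).congr_deriv ?_
    rw [smul_smul, ← add_smul]
    have : Real.exp (t / τ) * -(1 / τ) + Real.exp (t / τ) * (1 / τ) = 0 := by ring
    rw [this, zero_smul]
  have hconst : ∀ t, 0 ≤ t → Real.exp (t / τ) • (L (ω t) - η t) = -θ := by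
    intro t ht
    have := constant_of_has_deriv_right_zero (a := 0) (b := t)
      (f := fun u => Real.exp (u / τ) • (L (ω u) - η u))
      (fun x hx => (hg x hx.1).continuousAt.continuousWithinAt)
      (fun x hx => (hg x hx.1).hasDerivWithinAt) t ⟨ht, le_rfl⟩
    simpa [h0] using this
  have hle : ∀ t, 0 ≤ t → Real.exp (-t / τ) ≤ 1 := by
    intro t ht
    rw [Real.exp_le_one_iff]
    exact div_nonpos_of_nonpos_of_nonneg (by linarith) hτ.le
  have hδ : ∀ t, 0 ≤ t → ‖L (ω t) + θ - η t‖ = (1 - Real.exp (-t / τ)) * ‖θ‖ := by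
    intro t ht
    have h1 : L (ω t) - η t = -(Real.exp (-t / τ) • θ) := by
      rw [← smul_neg, ← hconst t ht, smul_smul, ← Real.exp_add]
      have : -t / τ + t / τ = 0 := by ring
      rw [this, Real.exp_zero, one_smul]
    have h2 : L (ω t) + θ - η t = (1 - Real.exp (-t / τ)) • θ := by
      rw [sub_smul, one_smul, add_sub_right_comm, h1]
      abel
    rw [h2, norm_smul, Real.norm_of_nonneg (by linarith [hle t ht])]
  intro t ht
  refine ⟨hδ t ht, ?_, ?_, ?_⟩
  · have h1 : HasDerivAt (fun u => (1 - Real.exp (-u / τ)) * ‖θ‖)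
        ((‖θ‖ / τ) * Real.exp (-t / τ)) t := by
      have := ((((hasDerivAt_id t).neg.div_const τ).exp).const_sub 1).mul_const ‖θ‖
      refine this.congr_deriv ?_
      simp only [Pi.neg_apply, id]
      ring
    exact h1.hasDerivWithinAt.congr (fun x hx => hδ x hx) (hδ t ht)
  · exact mul_le_of_le_one_right (by positivity) (hle t ht)
  · rw [hδ t ht]
    refine mul_le_mul_of_nonneg_right ?_ (norm_nonneg _)
    have := Real.add_one_le_exp (-t / τ)
    have h2 : -t / τ = -(t / τ) := by ring
    linarith
end
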